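/- For large n, the solution (α_0(n), β_0(n), d_0(n)) of the system 1 + d^2 − 2d cos α = 2 − 2 cos β, (n/8)(3α + β) = π/2, d = (2 cos(2α+β)+1)/(2 cos α + cos(3α+β)) satisfies the asymptotic expansions α_0(n) = π/n + π^5/(6n^5) + O(1/n^7), β_0(n) = π/n − π^5/(2n^5) + O(1/n^7), and d_0(n) = 1 − 4π^4/(3n^4) + O(1/n^6). -/

import Mathlib

open Real Filter Asymptotics

/-- The points `(t, x)` with `t → 0⁺` and `|x| ≤ t ^ 5`. -/
def thinCusp : Filter (ℝ × ℝ) :=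
  (nhdsWithin (0 : ℝ) (Set.Ioi 0)).comap Prod.fst ⊓ 𝓟 {p | |p.2| ≤ p.1 ^ 5}

/-- The quotient determining `d`, at the angles `α = t + x` and `β = t - 3 * x`. -/
noncomputable def diagLength (p : ℝ × ℝ) : ℝ :=
  (2 * cos (3 * p.1 - p.2) + 1) / (2 * cos (p.1 + p.2) + cos (4 * p.1))

/-- The defect of the first equation of the system, at the angles `α = t + x` and
`β = t - 3 * x`. -/
noncomputable def lengthDefect (p : ℝ × ℝ) : ℝ :=
  1 + diagLength p ^ 2 - 2 * diagLength p * cos (p.1 + p.2) - (2 - 2 * cos (p.1 - 3 * p.2))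

theorem sin_sub_self_isBigO : (fun u : ℝ => sin u - u) =O[nhds 0] fun u => u ^ 3 := by
  refine IsBigO.of_bound 1 ?_
  filter_upwards [Metric.ball_mem_nhds (0 : ℝ) one_pos] with u hu
  have hu1 : |u| ≤ 1 := by simpa using (Metric.mem_ball.1 hu).le
  have h := abs_le.1 (Real.sin_bound hu1)
  have h5 : |u| ^ 5 ≤ |u| ^ 3 := pow_le_pow_of_le_one (abs_nonneg u) hu1 (by norm_num)
  have h3 := abs_le.1 (abs_pow u 3).le
  have h0 : 0 ≤ |u| ^ 3 := by positivity
  rw [norm_pow, Real.norm_eq_abs, Real.norm_eq_abs, abs_le]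
  constructor <;> linarith

theorem one_sub_cos_sub_isBigO :
    (fun u : ℝ => 1 - cos u - u ^ 2 / 2) =O[nhds 0] fun u => u ^ 4 := by
  refine IsBigO.of_bound 1 ?_
  filter_upwards [Metric.ball_mem_nhds (0 : ℝ) one_pos] with u hu
  have hu1 : |u| ≤ 1 := by simpa using (Metric.mem_ball.1 hu).le
  have h := abs_le.1 (Real.cos_bound hu1)
  have h0 : 0 ≤ |u| ^ 4 := by positivity
  rw [norm_pow, Real.norm_eq_abs, Real.norm_eq_abs, abs_le]
  constructor <;> linarith

theorem one_sub_cos_isBigO : (fun u : ℝ => 1 - cos u) =O[nhds 0] fun u => u ^ 2 := by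
  refine IsBigO.of_bound 1 (Eventually.of_forall fun u => ?_)
  have h := Real.one_sub_sq_div_two_le_cos (x := u)
  have h' := Real.cos_le_one u
  rw [Real.norm_eq_abs, Real.norm_eq_abs, abs_of_nonneg (by linarith), abs_of_nonneg (sq_nonneg u)]
  nlinarith [sq_nonneg u]

theorem isBigO_mul_sub_mul {ι : Type*} {l : Filter ι} {f f₀ g g₀ t : ι → ℝ} {p q k : ℕ}
    (ht : t =O[l] fun _ => (1 : ℝ))
    (hf : (fun i => f i - f₀ i) =O[l] fun i => t i ^ (p + k)) (hf₀ : f₀ =O[l] fun i => t i ^ p)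
    (hg : (fun i => g i - g₀ i) =O[l] fun i => t i ^ (q + k)) (hg₀ : g₀ =O[l] fun i => t i ^ q) :
    (fun i => f i * g i - f₀ i * g₀ i) =O[l] fun i => t i ^ (p + q + k) := by
  have hk : (fun i => t i ^ k) =O[l] fun _ => (1 : ℝ) := by simpa using ht.pow k
  have hg' : g =O[l] fun i => t i ^ q := by
    have : (fun i => g i - g₀ i) =O[l] fun i => t i ^ q := by
      refine hg.trans ?_
      simpa [pow_add] using (isBigO_refl (fun i => t i ^ q) l).mul hk
    simpa using this.add hg₀
  have h1 := (hf.mul hg').add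
    ((hf₀.mul hg).congr_right (g₂ := fun i => t i ^ (p + k) * t i ^ q) fun i => by ring)
  exact h1.congr (fun i => by ring) fun i => by ring

theorem tendsto_fst_thinCusp : Tendsto Prod.fst thinCusp (nhds (0 : ℝ)) :=
  (tendsto_comap.mono_left inf_le_left).mono_right nhdsWithin_le_nhds

theorem fst_pow_isBigO_thinCusp {m k : ℕ} (h : m ≤ k) :
    (fun p : ℝ × ℝ => p.1 ^ k) =O[thinCusp] fun p => p.1 ^ m := by
  obtain ⟨j, rfl⟩ := Nat.exists_eq_add_of_le h
  have h1 : (fun p : ℝ × ℝ => p.1 ^ j) =O[thinCusp] fun _ => (1 : ℝ) := by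
    simpa using (tendsto_fst_thinCusp.isBigO_one ℝ).pow j
  simpa [pow_add] using (isBigO_refl (fun p : ℝ × ℝ => p.1 ^ m) _).mul h1

theorem snd_isBigO_thinCusp : (Prod.snd : ℝ × ℝ → ℝ) =O[thinCusp] fun p => p.1 ^ 5 := by
  refine IsBigO.of_bound 1 ?_
  have : ∀ᶠ p in thinCusp, |p.2| ≤ p.1 ^ 5 := mem_inf_of_right (mem_principal_self _)
  filter_upwards [this] with p hp
  simpa using hp.trans (le_abs_self _)

theorem linear_isBigO_thinCusp (a b : ℝ) :
    (fun p : ℝ × ℝ => a * p.1 + b * p.2) =O[thinCusp] fun p => p.1 := by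
  have h1 : (Prod.snd : ℝ × ℝ → ℝ) =O[thinCusp] fun p => p.1 := by
    simpa using snd_isBigO_thinCusp.trans (fst_pow_isBigO_thinCusp (m := 1) (by norm_num))
  exact ((isBigO_refl _ _).const_mul_left a).add (h1.const_mul_left b)

theorem tendsto_linear_thinCusp (a b : ℝ) :
    Tendsto (fun p : ℝ × ℝ => a * p.1 + b * p.2) thinCusp (nhds 0) :=
  (linear_isBigO_thinCusp a b).trans_tendsto tendsto_fst_thinCusp

theorem sin_linear_sub_isBigO (a b : ℝ) :
    (fun p : ℝ × ℝ => sin (a * p.1 + b * p.2) - a * p.1) =O[thinCusp] fun p => p.1 ^ 3 := by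
  have h1 := (sin_sub_self_isBigO.comp_tendsto (tendsto_linear_thinCusp a b)).trans
    ((linear_isBigO_thinCusp a b).pow 3)
  have h2 := (snd_isBigO_thinCusp.trans
    (fst_pow_isBigO_thinCusp (m := 3) (by norm_num))).const_mul_left b
  exact (h1.add h2).congr_left fun p => by simp only [Function.comp]; ring

theorem one_sub_cos_linear_isBigO (a b : ℝ) :
    (fun p : ℝ × ℝ => 1 - cos (a * p.1 + b * p.2)) =O[thinCusp] fun p => p.1 ^ 2 :=
  (one_sub_cos_isBigO.comp_tendsto (tendsto_linear_thinCusp a b)).trans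
    ((linear_isBigO_thinCusp a b).pow 2)

theorem one_sub_cos_fst_add_isBigO (b : ℝ) :
    (fun p : ℝ × ℝ => 1 - cos (p.1 + b * p.2) - p.1 ^ 2 / 2) =O[thinCusp] fun p => p.1 ^ 4 := by
  have h1 := (one_sub_cos_sub_isBigO.comp_tendsto (tendsto_linear_thinCusp 1 b)).trans
    ((linear_isBigO_thinCusp 1 b).pow 4)
  have h2 : (fun p : ℝ × ℝ => (1 * p.1 + b * p.2 + p.1) * (b / 2 * p.2)) =O[thinCusp]
      fun p => p.1 ^ 4 := by
    refine (((linear_isBigO_thinCusp 1 b).add (isBigO_refl _ _)).mul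
      (snd_isBigO_thinCusp.const_mul_left (b / 2))).trans ?_
    exact (fst_pow_isBigO_thinCusp (m := 4) (k := 6) (by norm_num)).congr_left fun p => by ring
  refine (h1.add h2).congr_left fun p => ?_
  simp only [Function.comp, one_mul]
  ring

theorem fst_isBigO_one_thinCusp : (Prod.fst : ℝ × ℝ → ℝ) =O[thinCusp] fun _ => (1 : ℝ) :=
  tendsto_fst_thinCusp.isBigO_one ℝ

theorem const_mul_fst_pow_isBigO (c : ℝ) (k : ℕ) :
    (fun p : ℝ × ℝ => c * p.1 ^ k) =O[thinCusp] fun p => p.1 ^ k :=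
  (isBigO_refl _ _).const_mul_left c

theorem denominator_sub_three_isBigO :
    (fun p : ℝ × ℝ => 2 * cos (p.1 + p.2) + cos (4 * p.1) - 3) =O[thinCusp] fun p => p.1 ^ 2 := by
  have h := ((one_sub_cos_linear_isBigO 1 1).const_mul_left (-2)).sub
    (one_sub_cos_linear_isBigO 4 0)
  exact h.congr_left fun p => by simp only [one_mul, zero_mul, add_zero]; ring

theorem eventually_one_le_denominator :
    ∀ᶠ p in thinCusp, 1 ≤ 2 * cos (p.1 + p.2) + cos (4 * p.1) := by
  have h0 : Tendsto (fun p : ℝ × ℝ => p.1 ^ 2) thinCusp (nhds 0) := by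
    simpa using tendsto_fst_thinCusp.pow 2
  have h := denominator_sub_three_isBigO.trans_tendsto h0
  filter_upwards [h.eventually (lt_mem_nhds (show (-2 : ℝ) < 0 by norm_num))] with p hp
  linarith

theorem numerator_gap_isBigO :
    (fun p : ℝ × ℝ => (2 * cos (p.1 + p.2) + cos (4 * p.1)) - (2 * cos (3 * p.1 - p.2) + 1)
      - 4 * p.1 ^ 4) =O[thinCusp] fun p => p.1 ^ 6 := by
  have hs : (fun p : ℝ × ℝ => sin p.1 - p.1) =O[thinCusp] fun p => p.1 ^ (1 + 2) :=
    (sin_linear_sub_isBigO 1 0).congr_left fun p => by simp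
  have hc : (fun p : ℝ × ℝ => (1 - cos p.1) - 1 / 2 * p.1 ^ 2) =O[thinCusp]
      fun p => p.1 ^ (2 + 2) :=
    (one_sub_cos_fst_add_isBigO 0).congr_left fun p => by simp only [zero_mul, add_zero]; ring
  have hp1 : (Prod.fst : ℝ × ℝ → ℝ) =O[thinCusp] fun p => p.1 ^ 1 := by
    simpa using isBigO_refl (Prod.fst : ℝ × ℝ → ℝ) thinCusp
  have hsc := isBigO_mul_sub_mul fst_isBigO_one_thinCusp hs hp1 hc (const_mul_fst_pow_isBigO _ 2)
  have hd : (fun p : ℝ × ℝ => sin (p.1 - p.2) - sin p.1) =O[thinCusp] fun p => p.1 ^ 5 := by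
    refine IsBigO.trans (IsBigO.of_bound 1 (Eventually.of_forall fun p => ?_)) snd_isBigO_thinCusp
    have h := Real.abs_sin_sub_sin_le (p.1 - p.2) p.1
    simpa using h
  have hb : (fun p : ℝ × ℝ => (2 * sin (p.1 - p.2) - sin (2 * p.1)) - 1 * p.1 ^ 3) =O[thinCusp]
      fun p => p.1 ^ (3 + 2) := by
    refine ((hsc.add hd).const_mul_left 2).congr_left fun p => ?_
    rw [sin_two_mul]
    ring
  have h2 : (fun p : ℝ × ℝ => sin (2 * p.1) - 2 * p.1 ^ 1) =O[thinCusp] fun p => p.1 ^ (1 + 2) :=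
    (sin_linear_sub_isBigO 2 0).congr_left fun p => by simp
  have h := (isBigO_mul_sub_mul fst_isBigO_one_thinCusp h2 (const_mul_fst_pow_isBigO _ 1) hb
    (const_mul_fst_pow_isBigO _ 3)).const_mul_left 2
  refine h.congr_left fun p => ?_
  have e1 : cos (p.1 + p.2) - cos (3 * p.1 - p.2) = 2 * sin (2 * p.1) * sin (p.1 - p.2) := by
    rw [cos_sub_cos, show (p.1 + p.2 + (3 * p.1 - p.2)) / 2 = 2 * p.1 by ring,
      show (p.1 + p.2 - (3 * p.1 - p.2)) / 2 = -(p.1 - p.2) by ring, sin_neg]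
    ring
  have e2 : cos (4 * p.1) = 1 - 2 * sin (2 * p.1) ^ 2 := by
    rw [show 4 * p.1 = 2 * (2 * p.1) by ring, cos_two_mul, cos_sq']
    ring
  linear_combination (-2) * e1 - e2

theorem one_sub_diagLength_isBigO :
    (fun p : ℝ × ℝ => (1 - diagLength p) - 4 / 3 * p.1 ^ 4) =O[thinCusp] fun p => p.1 ^ 6 := by
  have h1 := ((const_mul_fst_pow_isBigO (4 / 3) 4).mul denominator_sub_three_isBigO).congr_right
    (g₂ := fun p : ℝ × ℝ => p.1 ^ 6) fun p => by ring
  have hinv : (fun p : ℝ × ℝ => (2 * cos (p.1 + p.2) + cos (4 * p.1))⁻¹) =O[thinCusp]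
      fun _ => (1 : ℝ) := by
    refine IsBigO.of_bound 1 ?_
    filter_upwards [eventually_one_le_denominator] with p hp
    rw [norm_inv, Real.norm_eq_abs, abs_of_nonneg (by linarith)]
    simpa using inv_le_one_of_one_le₀ hp
  have h := ((numerator_gap_isBigO.sub h1).mul hinv).congr_right
    (g₂ := fun p : ℝ × ℝ => p.1 ^ 6) fun p => by ring
  refine h.congr' ?_ EventuallyEq.rfl
  filter_upwards [eventually_one_le_denominator] with p hp
  have hne := mul_inv_cancel₀ (zero_lt_one.trans_le hp).ne'
  rw [diagLength, div_eq_mul_inv]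
  linear_combination (1 - 4 / 3 * p.1 ^ 4) * hne

theorem lengthDefect_isBigO :
    (fun p : ℝ × ℝ => lengthDefect p - (8 * p.1 * p.2 - 4 / 3 * p.1 ^ 6)) =O[thinCusp]
      fun p => p.1 ^ 8 := by
  have hδ : (fun p : ℝ × ℝ => 1 - diagLength p) =O[thinCusp] fun p => p.1 ^ 4 := by
    have := (one_sub_diagLength_isBigO.trans (fst_pow_isBigO_thinCusp (m := 4) (by norm_num))).add
      (const_mul_fst_pow_isBigO (4 / 3) 4)
    simpa using this
  have hδ2 := (hδ.pow 2).congr_right (g₂ := fun p : ℝ × ℝ => p.1 ^ 8) fun p => by ring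
  have hc : (fun p : ℝ × ℝ => (1 - cos (p.1 + p.2)) - 1 / 2 * p.1 ^ 2) =O[thinCusp]
      fun p => p.1 ^ (2 + 2) :=
    (one_sub_cos_fst_add_isBigO 1).congr_left fun p => by simp only [one_mul]; ring
  have hδc := (isBigO_mul_sub_mul (p := 4) fst_isBigO_one_thinCusp one_sub_diagLength_isBigO
    (const_mul_fst_pow_isBigO _ 4) hc (const_mul_fst_pow_isBigO _ 2)).const_mul_left (-2)
  have hs : (fun p : ℝ × ℝ => sin (p.1 - p.2) - 1 * p.1 ^ 1) =O[thinCusp]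
      fun p => p.1 ^ (1 + 2) :=
    (sin_linear_sub_isBigO 1 (-1)).congr_left fun p => by
      rw [show 1 * p.1 + -1 * p.2 = p.1 - p.2 by ring]; ring
  have hx : (fun p : ℝ × ℝ => sin (2 * p.2) - 2 * p.2) =O[thinCusp] fun p => p.1 ^ (5 + 2) := by
    have ht : Tendsto (fun p : ℝ × ℝ => 2 * p.2) thinCusp (nhds 0) := by
      simpa using tendsto_linear_thinCusp 0 2
    refine (sin_sub_self_isBigO.comp_tendsto ht).trans ?_
    refine ((snd_isBigO_thinCusp.const_mul_left 2).pow 3).trans ?_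
    exact (fst_pow_isBigO_thinCusp (m := 7) (k := 15) (by norm_num)).congr_left fun p => by ring
  have hsx := (isBigO_mul_sub_mul fst_isBigO_one_thinCusp hs (const_mul_fst_pow_isBigO _ 1) hx
    (snd_isBigO_thinCusp.const_mul_left 2)).const_mul_left 4
  refine ((hδ2.add hδc).add hsx).congr_left fun p => ?_
  have e : cos (p.1 - 3 * p.2) - cos (p.1 + p.2) = 2 * sin (p.1 - p.2) * sin (2 * p.2) := by
    rw [cos_sub_cos, show (p.1 - 3 * p.2 + (p.1 + p.2)) / 2 = p.1 - p.2 by ring,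
      show (p.1 - 3 * p.2 - (p.1 + p.2)) / 2 = -(2 * p.2) by ring, sin_neg]
    ring
  unfold lengthDefect
  linear_combination (-2) * e

theorem eventually_thinCusp_iff {P : ℝ × ℝ → Prop} :
    (∀ᶠ p in thinCusp, P p) ↔
      ∀ᶠ t in nhdsWithin (0 : ℝ) (Set.Ioi 0), ∀ x, |x| ≤ t ^ 5 → P (t, x) := by
  rw [thinCusp, eventually_inf_principal, eventually_comap]
  refine eventually_congr (Eventually.of_forall fun t => ⟨fun h x hx => h (t, x) rfl hx, ?_⟩)
  rintro h ⟨_, x⟩ rfl hx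
  exact h x hx

theorem exists_lengthDefect_eq_zero :
    ∃ K : ℝ, ∀ᶠ t in nhdsWithin (0 : ℝ) (Set.Ioi 0), ∃ x : ℝ,
      lengthDefect (t, x) = 0 ∧ |x - t ^ 5 / 6| ≤ K * t ^ 7 ∧
        |diagLength (t, x) - (1 - 4 / 3 * t ^ 4)| ≤ K * t ^ 6 := by
  obtain ⟨A, hA0, hA⟩ := lengthDefect_isBigO.exists_pos
  obtain ⟨B, hB0, hB⟩ := one_sub_diagLength_isBigO.exists_pos
  refine ⟨A + B, ?_⟩
  have hsmall : ∀ᶠ t in nhdsWithin (0 : ℝ) (Set.Ioi 0), A * t ^ 2 < 1 / 2 := by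
    have h : Tendsto (fun t : ℝ => A * t ^ 2) (nhds 0) (nhds (A * 0 ^ 2)) :=
      Continuous.tendsto (by fun_prop) 0
    exact (h.mono_left nhdsWithin_le_nhds).eventually (gt_mem_nhds (by norm_num))
  filter_upwards [self_mem_nhdsWithin, hsmall, eventually_thinCusp_iff.1 hA.bound,
    eventually_thinCusp_iff.1 hB.bound,
    eventually_thinCusp_iff.1 eventually_one_le_denominator] with t ht0 hts hF hd hD
  have ht : 0 < t := ht0
  have h5 : 0 < t ^ 5 := by positivity
  have h7 : 0 < t ^ 7 := by positivity
  have h75 : A * t ^ 7 ≤ t ^ 5 / 2 := by nlinarith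
  have hcusp : ∀ x ∈ Set.Icc (t ^ 5 / 6 - A * t ^ 7) (t ^ 5 / 6 + A * t ^ 7), |x| ≤ t ^ 5 := by
    intro x hx
    rw [abs_le]
    constructor <;> linarith [hx.1, hx.2]
  have hle : t ^ 5 / 6 - A * t ^ 7 ≤ t ^ 5 / 6 + A * t ^ 7 := by nlinarith
  have hcont : ContinuousOn (fun x => lengthDefect (t, x))
      (Set.Icc (t ^ 5 / 6 - A * t ^ 7) (t ^ 5 / 6 + A * t ^ 7)) := by
    have hdc : ContinuousOn (fun x => diagLength (t, x))
        (Set.Icc (t ^ 5 / 6 - A * t ^ 7) (t ^ 5 / 6 + A * t ^ 7)) := by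
      refine ContinuousOn.div (by fun_prop) (by fun_prop) fun x hx => ?_
      have := hD x (hcusp x hx)
      exact (zero_lt_one.trans_le this).ne'
    unfold lengthDefect
    fun_prop
  have h8 : 0 < A * t ^ 8 := by positivity
  have hF' : ∀ x ∈ Set.Icc (t ^ 5 / 6 - A * t ^ 7) (t ^ 5 / 6 + A * t ^ 7),
      |lengthDefect (t, x) - (8 * t * x - 4 / 3 * t ^ 6)| ≤ A * t ^ 8 := by
    intro x hx
    simpa [abs_of_pos ht] using hF x (hcusp x hx)
  have hlo := (abs_le.1 (hF' _ (Set.left_mem_Icc.2 hle))).2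
  have hhi := (abs_le.1 (hF' _ (Set.right_mem_Icc.2 hle))).1
  obtain ⟨x, hx, hx0⟩ := intermediate_value_Icc hle hcont
    (show (0 : ℝ) ∈ Set.Icc _ _ from ⟨by nlinarith, by nlinarith⟩)
  refine ⟨x, hx0, ?_, ?_⟩
  · have : 0 < B * t ^ 7 := by positivity
    rw [abs_le]
    constructor <;> linarith [hx.1, hx.2]
  · have h := hd x (hcusp x hx)
    have h6 : 0 < A * t ^ 6 := by positivity
    rw [norm_pow, Real.norm_eq_abs, Real.norm_eq_abs, abs_of_pos ht] at h
    rw [← abs_neg, show -(diagLength (t, x) - (1 - 4 / 3 * t ^ 4))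
      = 1 - diagLength (t, x) - 4 / 3 * t ^ 4 by ring]
    linarith

/-- Asymptotic expansion of the solution of the system determining the polygon `G_n`. -/
theorem Gn_system_asymptotics :
    ∃ α β d : ℕ → ℝ,
      (∀ᶠ n : ℕ in atTop,
        (1 + (d n)^2 - 2*(d n)*cos (α n) = 2 - 2*cos (β n)) ∧
        ((n : ℝ)/8 * (3*(α n) + β n) = π/2) ∧
        (d n = (2*cos (2*(α n) + β n) + 1) / (2*cos (α n) + cos (3*(α n) + β n)))) ∧
      (fun n : ℕ => α n - (π/n + π^5/(6*(n:ℝ)^5))) =O[atTop] (fun n : ℕ => 1/(n:ℝ)^7) ∧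
      (fun n : ℕ => β n - (π/n - π^5/(2*(n:ℝ)^5))) =O[atTop] (fun n : ℕ => 1/(n:ℝ)^7) ∧
      (fun n : ℕ => d n - (1 - 4*π^4/(3*(n:ℝ)^4))) =O[atTop] (fun n : ℕ => 1/(n:ℝ)^6) := by
  obtain ⟨K, hK⟩ := exists_lengthDefect_eq_zero
  have htend : Tendsto (fun n : ℕ => π / (n : ℝ)) atTop (nhdsWithin 0 (Set.Ioi 0)) := by
    refine tendsto_nhdsWithin_iff.2 ⟨tendsto_const_div_atTop_nhds_zero_nat π, ?_⟩
    filter_upwards [eventually_gt_atTop 0] with n hn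
    have : (0 : ℝ) < n := Nat.cast_pos.2 hn
    exact div_pos pi_pos this
  have hn := htend.eventually hK
  obtain ⟨x, hx⟩ := hn.choice
  have hx : ∀ᶠ n : ℕ in atTop, 0 < (n : ℝ) ∧ lengthDefect (π / n, x n) = 0 ∧
      |x n - (π / n) ^ 5 / 6| ≤ K * (π / n) ^ 7 ∧
        |diagLength (π / n, x n) - (1 - 4 / 3 * (π / n) ^ 4)| ≤ K * (π / n) ^ 6 := by
    filter_upwards [hx, eventually_gt_atTop 0] with n hn h0
    exact ⟨Nat.cast_pos.2 h0, hn⟩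
  have hα : (fun n : ℕ => x n - (π / n) ^ 5 / 6) =O[atTop] fun n : ℕ => 1 / (n : ℝ) ^ 7 := by
    refine IsBigO.of_bound (K * π ^ 7) ?_
    filter_upwards [hx] with n ⟨h0, _, h, _⟩
    rw [Real.norm_eq_abs, Real.norm_eq_abs, abs_of_pos (by positivity : 0 < 1 / (n : ℝ) ^ 7)]
    exact h.trans_eq (by rw [div_pow]; ring)
  refine ⟨fun n => π / n + x n, fun n => π / n - 3 * x n, fun n => diagLength (π / n, x n),
    ?_, ?_, ?_, ?_⟩
  · filter_upwards [hx] with n ⟨h0, hz, _, _⟩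
    refine ⟨sub_eq_zero.1 hz, ?_, ?_⟩
    · field_simp
      ring
    · simp only [diagLength]
      ring_nf
  · exact hα.congr_left fun n => by rw [div_pow]; ring
  · exact (hα.const_mul_left (-3)).congr_left fun n => by rw [div_pow]; ring
  · refine IsBigO.of_bound (K * π ^ 6) ?_
    filter_upwards [hx] with n ⟨h0, _, _, h⟩
    rw [Real.norm_eq_abs, Real.norm_eq_abs, abs_of_pos (by positivity : 0 < 1 / (n : ℝ) ^ 6)]
    rw [show 4 * π ^ 4 / (3 * (n : ℝ) ^ 4) = 4 / 3 * (π / n) ^ 4 by rw [div_pow]; ring]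
    exact h.trans_eq (by rw [div_pow]; ring)
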